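/- Let n ≥ 2 be an integer, let Σ be an n×n real symmetric positive definite matrix, let D be the (n−1)×n first-difference matrix, let X be a real n×k matrix, and let Y ∈ ℝⁿ. Set c := 𝟙ᵀΣ⁻¹𝟙, Ω := Σ⁻¹ − c⁻¹ · Σ⁻¹𝟙𝟙ᵀΣ⁻¹ and Ψ := Dᵀ(DΣDᵀ)⁻¹D, and assume XᵀΩX is invertible. If b₀ ∈ ℝ and b₁ ∈ ℝᵏ satisfy the level-model GLS normal equations 𝟙ᵀΣ⁻¹(Y − b₀𝟙 − Xb₁) = 0 and XᵀΣ⁻¹(Y − b₀𝟙 − Xb₁) = 0, and b ∈ ℝᵏ satisfies the difference-model GLS normal equation (DX)ᵀ(DΣDᵀ)⁻¹(DY − DXb) = 0, then b₁ = b; that is, the GLS slope estimates in the level model with intercept and in the first-difference model coincide. -/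

import Mathlib

open Matrix

lemma diff_mulVec (n : ℕ) (D : Matrix (Fin (n - 1)) (Fin n) ℝ)
    (hD : ∀ i j, D i j =
      if (j : ℕ) = (i : ℕ) then -1 else if (j : ℕ) = (i : ℕ) + 1 then 1 else 0)
    (v : Fin n → ℝ) (i : Fin (n - 1)) :
    (D *ᵥ v) i = v ⟨i + 1, by omega⟩ - v ⟨i, by omega⟩ := by
  have h : ∀ j : Fin n, D i j * v j = (if j = ⟨i + 1, by omega⟩ then v j else 0)
      - (if j = ⟨i, by omega⟩ then v j else 0) := by
    intro j
    rw [hD]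
    simp only [Fin.ext_iff]
    split_ifs <;> first | omega | ring
  simp only [mulVec, dotProduct, h, Finset.sum_sub_distrib]
  simp

lemma diff_one (n : ℕ) (D : Matrix (Fin (n - 1)) (Fin n) ℝ)
    (hD : ∀ i j, D i j =
      if (j : ℕ) = (i : ℕ) then -1 else if (j : ℕ) = (i : ℕ) + 1 then 1 else 0) :
    D *ᵥ (1 : Fin n → ℝ) = 0 := by
  ext i
  rw [diff_mulVec n D hD]
  simp

lemma diff_ker (n : ℕ) (hn : 2 ≤ n) (D : Matrix (Fin (n - 1)) (Fin n) ℝ)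
    (hD : ∀ i j, D i j =
      if (j : ℕ) = (i : ℕ) then -1 else if (j : ℕ) = (i : ℕ) + 1 then 1 else 0)
    (v : Fin n → ℝ) (hv : D *ᵥ v = 0) : ∃ a : ℝ, v = a • (1 : Fin n → ℝ) := by
  refine ⟨v ⟨0, by omega⟩, ?_⟩
  have key : ∀ m : ℕ, ∀ hm : m < n, v ⟨m, hm⟩ = v ⟨0, by omega⟩ := by
    intro m
    induction m with
    | zero => intro _; rfl
    | succ m ih =>
      intro hm
      have h := congrFun hv ⟨m, by omega⟩
      rw [diff_mulVec n D hD] at h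
      have h2 := ih (by omega)
      simp only [Pi.zero_apply] at h
      linarith
  ext ⟨m, hm⟩
  simp [key m hm]

lemma diff_right_inv (n : ℕ) (D : Matrix (Fin (n - 1)) (Fin n) ℝ)
    (hD : ∀ i j, D i j =
      if (j : ℕ) = (i : ℕ) then -1 else if (j : ℕ) = (i : ℕ) + 1 then 1 else 0) :
    ∃ L : Matrix (Fin n) (Fin (n - 1)) ℝ, D * L = 1 := by
  refine ⟨Matrix.of fun j i => if (i : ℕ) < (j : ℕ) then 1 else 0, ?_⟩
  ext i l
  have h := diff_mulVec n D hD (fun j => if (l : ℕ) < (j : ℕ) then 1 else 0) i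
  have h' : (D * (Matrix.of fun (j : Fin n) (i : Fin (n - 1)) =>
      if (i : ℕ) < (j : ℕ) then (1 : ℝ) else 0)) i l =
      (D *ᵥ (fun j => if (l : ℕ) < (j : ℕ) then 1 else 0)) i := by
    simp [Matrix.mul_apply, mulVec, dotProduct]
  rw [h', h, Matrix.one_apply]
  simp only [Fin.ext_iff]
  split_ifs <;> first | omega | norm_num

/-- The GLS slope estimates in the level model with intercept and in the
first-difference model coincide. -/
theorem gls_slope_level_eq_difference (n k : ℕ) (hn : 2 ≤ n)
    (S : Matrix (Fin n) (Fin n) ℝ) (hS : S.PosDef)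
    (D : Matrix (Fin (n - 1)) (Fin n) ℝ)
    (hD : ∀ i j, D i j =
      if (j : ℕ) = (i : ℕ) then -1 else if (j : ℕ) = (i : ℕ) + 1 then 1 else 0)
    (X : Matrix (Fin n) (Fin k) ℝ) (Y : Fin n → ℝ)
    (c : ℝ) (hc : c = (1 : Fin n → ℝ) ⬝ᵥ (S⁻¹ *ᵥ (1 : Fin n → ℝ)))
    (Ω : Matrix (Fin n) (Fin n) ℝ)
    (hΩ : Ω = S⁻¹ - c⁻¹ • vecMulVec (S⁻¹ *ᵥ (1 : Fin n → ℝ)) ((1 : Fin n → ℝ) ᵥ* S⁻¹))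
    (Ψ : Matrix (Fin n) (Fin n) ℝ)
    (hΨ : Ψ = Dᵀ * (D * S * Dᵀ)⁻¹ * D)
    (hXΩX : IsUnit (Xᵀ * Ω * X).det)
    (b₀ : ℝ) (b₁ : Fin k → ℝ)
    (h1 : (1 : Fin n → ℝ) ⬝ᵥ (S⁻¹ *ᵥ (Y - b₀ • (1 : Fin n → ℝ) - X *ᵥ b₁)) = 0)
    (h2 : Xᵀ *ᵥ (S⁻¹ *ᵥ (Y - b₀ • (1 : Fin n → ℝ) - X *ᵥ b₁)) = 0)
    (b : Fin k → ℝ)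
    (h3 : (D * X)ᵀ *ᵥ ((D * S * Dᵀ)⁻¹ *ᵥ (D *ᵥ Y - (D * X) *ᵥ b)) = 0) :
    b₁ = b := by
  have hM : (D * S * Dᵀ).PosDef := by
    have hinj : Function.Injective D.vecMul := by
      obtain ⟨L, hL⟩ := diff_right_inv n D hD
      intro x y hxy
      have := congrArg (fun z => z ᵥ* L) hxy
      simpa [Matrix.vecMul_vecMul, hL] using this
    simpa using hS.mul_mul_conjTranspose_same hinj
  have hSu : IsUnit S.det := hS.det_pos.ne'.isUnit
  have hMu : IsUnit (D * S * Dᵀ).det := hM.det_pos.ne'.isUnit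
  have hone := diff_one n D hD
  have hcpos : 0 < c := by
    have h := hS.inv.dotProduct_mulVec_pos (x := (1 : Fin n → ℝ)) (by
      intro h
      simpa using congrFun h ⟨0, by omega⟩)
    rw [hc]
    simpa using h
  have hST : Sᵀ = S := by simpa using hS.isHermitian.eq
  have hΩv : ∀ v, Ω *ᵥ v =
      S⁻¹ *ᵥ v - (c⁻¹ * ((1 : Fin n → ℝ) ⬝ᵥ (S⁻¹ *ᵥ v))) • (S⁻¹ *ᵥ (1 : Fin n → ℝ)) := by
    intro v
    rw [hΩ, Matrix.sub_mulVec, Matrix.smul_mulVec, Matrix.vecMulVec_mulVec,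
      Matrix.dotProduct_mulVec, op_smul_eq_smul, smul_smul]
  have hΨv : ∀ v, Ψ *ᵥ v = Dᵀ *ᵥ ((D * S * Dᵀ)⁻¹ *ᵥ (D *ᵥ v)) := by
    intro v
    rw [hΨ]
    simp only [Matrix.mulVec_mulVec, Matrix.mul_assoc]
  have hSS : ∀ v, S *ᵥ (S⁻¹ *ᵥ v) = v := by
    intro v
    rw [Matrix.mulVec_mulVec, Matrix.mul_nonsing_inv _ hSu, Matrix.one_mulVec]
  have hSS' : ∀ v, S⁻¹ *ᵥ (S *ᵥ v) = v := by
    intro v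
    rw [Matrix.mulVec_mulVec, Matrix.nonsing_inv_mul _ hSu, Matrix.one_mulVec]
  have hEq : ∀ v, Ψ *ᵥ v = Ω *ᵥ v := by
    intro v
    have e1 : D *ᵥ (S *ᵥ (Ω *ᵥ v)) = D *ᵥ v := by
      rw [hΩv, Matrix.mulVec_sub, Matrix.mulVec_smul, hSS, hSS, Matrix.mulVec_sub,
        Matrix.mulVec_smul, hone]
      simp
    have e2 : D *ᵥ (S *ᵥ (Ψ *ᵥ v)) = D *ᵥ v := by
      have : D *ᵥ (S *ᵥ (Ψ *ᵥ v)) =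
          (D * S * Dᵀ) *ᵥ ((D * S * Dᵀ)⁻¹ *ᵥ (D *ᵥ v)) := by
        rw [hΨv]
        simp only [Matrix.mulVec_mulVec, Matrix.mul_assoc]
      rw [this, Matrix.mulVec_mulVec, Matrix.mul_nonsing_inv _ hMu, Matrix.one_mulVec]
    obtain ⟨a, ha⟩ := diff_ker n hn D hD (S *ᵥ (Ψ *ᵥ v - Ω *ᵥ v)) (by
      rw [Matrix.mulVec_sub, Matrix.mulVec_sub, e1, e2, sub_self])
    have hd : Ψ *ᵥ v - Ω *ᵥ v = a • (S⁻¹ *ᵥ (1 : Fin n → ℝ)) := by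
      rw [← hSS' (Ψ *ᵥ v - Ω *ᵥ v), ha, Matrix.mulVec_smul]
    have f1 : (1 : Fin n → ℝ) ⬝ᵥ (Ω *ᵥ v) = 0 := by
      rw [hΩv, dotProduct_sub, dotProduct_smul, ← hc, smul_eq_mul]
      field_simp
      ring
    have f2 : (1 : Fin n → ℝ) ⬝ᵥ (Ψ *ᵥ v) = 0 := by
      rw [hΨv, Matrix.dotProduct_mulVec, Matrix.vecMul_transpose, hone, zero_dotProduct]
    have h := congrArg (fun z => (1 : Fin n → ℝ) ⬝ᵥ z) hd
    simp only [dotProduct_sub, dotProduct_smul, f1, f2, ← hc, smul_eq_mul, sub_zero] at h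
    have ha0 : a = 0 := by
      rcases mul_eq_zero.mp h.symm with h | h
      · exact h
      · exact absurd h hcpos.ne'
    rw [ha0, zero_smul] at hd
    exact sub_eq_zero.mp hd
  have hΩ1 : Ω *ᵥ (1 : Fin n → ℝ) = 0 := by
    rw [← hEq, hΨv, hone]
    simp
  have g1 : Xᵀ *ᵥ (Ω *ᵥ (Y - X *ᵥ b₁)) = 0 := by
    have : Ω *ᵥ (Y - X *ᵥ b₁) = Ω *ᵥ (Y - b₀ • (1 : Fin n → ℝ) - X *ᵥ b₁) := by
      rw [sub_right_comm, Matrix.mulVec_sub Ω (Y - X *ᵥ b₁), Matrix.mulVec_smul, hΩ1]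
      simp
    rw [this, hΩv, h1]
    simpa using h2
  have g2 : Xᵀ *ᵥ (Ω *ᵥ (Y - X *ᵥ b)) = 0 := by
    rw [← hEq, hΨv, ← h3, Matrix.transpose_mul, Matrix.mulVec_sub D,
      ← Matrix.mulVec_mulVec _ Xᵀ Dᵀ, Matrix.mulVec_mulVec b D X]
  have g3 : (Xᵀ * Ω * X) *ᵥ (b₁ - b) = 0 := by
    have : (Xᵀ * Ω * X) *ᵥ (b₁ - b) =
        Xᵀ *ᵥ (Ω *ᵥ (Y - X *ᵥ b)) - Xᵀ *ᵥ (Ω *ᵥ (Y - X *ᵥ b₁)) := by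
      rw [← Matrix.mulVec_sub, ← Matrix.mulVec_sub, sub_sub_sub_cancel_left,
        ← Matrix.mulVec_sub]
      simp only [Matrix.mulVec_mulVec, Matrix.mul_assoc]
    rw [this, g1, g2, sub_zero]
  have := congrArg (fun z => (Xᵀ * Ω * X)⁻¹ *ᵥ z) g3
  simp only [Matrix.mulVec_mulVec, Matrix.nonsing_inv_mul _ hXΩX, Matrix.one_mulVec,
    Matrix.mulVec_zero] at this
  exact sub_eq_zero.mp this
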